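/- arXiv:1501.03170 — 2 statements merged into one kernel-verified Lean document; each statement's English description precedes it below -/
import Mathlib

section
/- A positive integer n is an abelian number (i.e., every group of order n is abelian) if and only if n = p_1^{a_1} ⋯ p_r^{a_r} for distinct primes p_1, …, p_r where each a_i ≤ 2 and gcd(p_i, p_j^{a_j} − 1) = 1 whenever i ≠ j. -/
/-- Heisenberg group carrier over a commutative ring. -/
structure AbNumHeis (R : Type) where
  a : R
  b : R
  c : R

/-- Affine maps `x ↦ u x + a` with `u` in a given group of units. -/
structure AbNumAff (F : Type) [Field F] (U : Subgroup Fˣ) where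
  a : F
  u : U

theorem AbNumHeis.ext' {R : Type} {x y : AbNumHeis R} (h1 : x.a = y.a) (h2 : x.b = y.b)
    (h3 : x.c = y.c) : x = y := by
  cases x; cases y; simp_all

theorem AbNumAff.ext' {F : Type} [Field F] {U : Subgroup Fˣ} {x y : AbNumAff F U}
    (h1 : x.a = y.a) (h2 : x.u = y.u) : x = y := by
  cases x; cases y; simp_all

instance (R : Type) [CommRing R] : Group (AbNumHeis R) where
  mul x y := ⟨x.a + y.a, x.b + y.b, x.c + y.c + x.a * y.b⟩
  one := ⟨0, 0, 0⟩
  inv x := ⟨-x.a, -x.b, -x.c + x.a * x.b⟩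
  mul_assoc x y z := AbNumHeis.ext' (add_assoc _ _ _) (add_assoc _ _ _)
    (show (x.c + y.c + x.a * y.b) + z.c + (x.a + y.a) * z.b
      = x.c + (y.c + z.c + y.a * z.b) + x.a * (y.b + z.b) by ring)
  one_mul x := AbNumHeis.ext' (zero_add _) (zero_add _)
    (show 0 + x.c + 0 * x.b = x.c by ring)
  mul_one x := AbNumHeis.ext' (add_zero _) (add_zero _)
    (show x.c + 0 + x.a * 0 = x.c by ring)
  inv_mul_cancel x := AbNumHeis.ext' (neg_add_cancel _) (neg_add_cancel _)
    (show -x.c + x.a * x.b + x.c + -x.a * x.b = 0 by ring)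

instance (F : Type) [Field F] (U : Subgroup Fˣ) : Group (AbNumAff F U) where
  mul x y := ⟨x.a + ((x.u : Fˣ) : F) * y.a, x.u * y.u⟩
  one := ⟨0, 1⟩
  inv x := ⟨-(((x.u⁻¹ : U) : Fˣ) : F) * x.a, x.u⁻¹⟩
  mul_assoc x y z := AbNumAff.ext'
    (show (x.a + ((x.u : Fˣ) : F) * y.a) + ((((x.u * y.u : U) : Fˣ)) : F) * z.a
      = x.a + ((x.u : Fˣ) : F) * (y.a + ((y.u : Fˣ) : F) * z.a) by push_cast; ring)
    (mul_assoc _ _ _)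
  one_mul x := AbNumAff.ext'
    (show 0 + (((1 : U) : Fˣ) : F) * x.a = x.a by simp) (one_mul _)
  mul_one x := AbNumAff.ext'
    (show x.a + ((x.u : Fˣ) : F) * 0 = x.a by simp) (mul_one _)
  inv_mul_cancel x := AbNumAff.ext'
    (show -(((x.u⁻¹ : U) : Fˣ) : F) * x.a + (((x.u⁻¹ : U) : Fˣ) : F) * x.a = 0 by ring)
    (inv_mul_cancel _)

theorem AbNumHeis.card (R : Type) : Nat.card (AbNumHeis R) = Nat.card R ^ 3 := by
  have e : AbNumHeis R ≃ R × R × R :=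
    ⟨fun x => (x.a, x.b, x.c), fun y => ⟨y.1, y.2.1, y.2.2⟩, fun _ => rfl, fun _ => rfl⟩
  rw [Nat.card_congr e, Nat.card_prod, Nat.card_prod]; ring

theorem AbNumAff.card (F : Type) [Field F] (U : Subgroup Fˣ) :
    Nat.card (AbNumAff F U) = Nat.card F * Nat.card U := by
  have e : AbNumAff F U ≃ F × U :=
    ⟨fun x => (x.a, x.u), fun y => ⟨y.1, y.2⟩, fun _ => rfl, fun _ => rfl⟩
  rw [Nat.card_congr e, Nat.card_prod]

/-- A nonabelian group whose order divides `n` rules out that `n` is an abelian number. -/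
theorem abNum_comm_of_dvd {n : ℕ} (hn : 0 < n)
    (H : ∀ (G : Type) [Group G] [Fintype G], Fintype.card G = n → ∀ x y : G, x * y = y * x)
    (K : Type) [Group K] (hK : Nat.card K ∣ n) (x y : K) : x * y = y * x := by
  obtain ⟨m, hm⟩ := hK
  have hK0 : Nat.card K ≠ 0 := by rintro h; simp [h] at hm; omega
  have hm0 : m ≠ 0 := by rintro h; simp [h] at hm; omega
  have : Finite K := Nat.finite_of_card_ne_zero hK0
  have : NeZero m := ⟨hm0⟩
  let : Fintype K := Fintype.ofFinite K
  have := H (K × Multiplicative (ZMod m)) (by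
    rw [Fintype.card_eq_nat_card, Nat.card_prod, hm]
    congr 1
    exact (Nat.card_congr Multiplicative.toAdd).trans (Nat.card_zmod m)) (x, 1) (y, 1)
  exact congrArg Prod.fst this

theorem abNum_heis {n p : ℕ} (hn : 0 < n)
    (H : ∀ (G : Type) [Group G] [Fintype G], Fintype.card G = n → ∀ x y : G, x * y = y * x)
    (hp : p.Prime) : ¬ p ^ 3 ∣ n := by
  intro h
  have := Fact.mk hp
  have := abNum_comm_of_dvd hn H (AbNumHeis (ZMod p))
    (by rwa [AbNumHeis.card, Nat.card_zmod]) ⟨1, 0, 0⟩ ⟨0, 1, 0⟩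
  have h2 : (0 + 0 + 1 * 1 : ZMod p) = 0 + 0 + 0 * 0 := congrArg AbNumHeis.c this
  simp at h2

theorem abNum_aff {n p q a : ℕ} (hn : 0 < n)
    (H : ∀ (G : Type) [Group G] [Fintype G], Fintype.card G = n → ∀ x y : G, x * y = y * x)
    (hp : p.Prime) (hq : q.Prime) (ha : a ≠ 0) (hd : q ^ a * p ∣ n) : ¬ p ∣ q ^ a - 1 := by
  intro h
  have := Fact.mk hp
  have := Fact.mk hq
  have hc : Nat.card (GaloisField q a)ˣ = q ^ a - 1 := by
    rw [Nat.card_units, GaloisField.card q a ha]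
  obtain ⟨u, hu⟩ := exists_prime_orderOf_dvd_card' (G := (GaloisField q a)ˣ) p (hc ▸ h)
  have := abNum_comm_of_dvd hn H (AbNumAff (GaloisField q a) (Subgroup.zpowers u))
    (by rwa [AbNumAff.card, GaloisField.card q a ha, Nat.card_zpowers, hu])
    ⟨1, 1⟩ ⟨0, ⟨u, Subgroup.mem_zpowers u⟩⟩
  have h2 : (1 + (((1 : Subgroup.zpowers u) : (GaloisField q a)ˣ) : GaloisField q a) * 0 :
    GaloisField q a) = 0 + (u : GaloisField q a) * 1 := congrArg AbNumAff.a this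
  have h3 : u = 1 := by
    apply Units.ext
    simpa using h2.symm
  rw [h3, orderOf_one] at hu
  exact hp.one_lt.ne hu

theorem abNum_le_centralizer {G : Type} [Group G] [Finite G] {p q a : ℕ} (hp : p.Prime)
    (hq : q.Prime) (hpq : q ≠ p) (P Q : Subgroup G) (hP : Nat.card P = p ^ a) (ha : a ≤ 2)
    (hQ : IsPGroup q Q) (hN : Q ≤ Subgroup.normalizer (P : Set G)) (hd : ¬ q ∣ p ^ a - 1) :
    Q ≤ Subgroup.centralizer (P : Set G) := by
  have := Fact.mk hq
  let := MulDistribMulAction.compHom P (P.normalizerMonoidHom.comp (Subgroup.inclusion hN))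
  have key := hQ.card_modEq_card_fixedPoints P
  have hsm : ∀ (g : Q) (x : P), ((g • x : P) : G) = g * x * (g : G)⁻¹ := fun g x => rfl
  have hfix : MulAction.fixedPoints Q P
      = (((Subgroup.centralizer (Q : Set G)).subgroupOf P : Subgroup P) : Set P) := by
    ext x
    simp only [MulAction.mem_fixedPoints, SetLike.mem_coe, Subgroup.mem_subgroupOf,
      Subgroup.mem_centralizer_iff, Subtype.ext_iff, hsm, mul_inv_eq_iff_eq_mul]
    exact ⟨fun h g hg => h ⟨g, hg⟩, fun h g => h g g.2⟩
  rw [hfix] at key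
  set D := (Subgroup.centralizer (Q : Set G)).subgroupOf P with hD
  have hDc : Nat.card D ∣ p ^ a := hP ▸ Subgroup.card_subgroup_dvd_card D
  obtain ⟨b, hb, hDb⟩ := (Nat.dvd_prime_pow hp).1 hDc
  have key2 : p ^ a ≡ p ^ b [MOD q] := by
    rw [← hP, ← hDb]; exact key
  have hab : b = a := by
    by_contra hne
    have hlt : b < a := by omega
    have h1 : q ∣ p ^ a - p ^ b :=
      (Nat.modEq_iff_dvd' (Nat.pow_le_pow_right hp.pos hb)).1 key2.symm
    have h2 : p ^ a - p ^ b = p ^ b * (p ^ (a - b) - 1) := by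
      rw [Nat.mul_sub, ← pow_add, Nat.add_sub_cancel' hb, mul_one]
    rw [h2] at h1
    rcases hq.dvd_mul.1 h1 with h | h
    · exact hpq ((Nat.prime_dvd_prime_iff_eq hq hp).1 (hq.dvd_of_dvd_pow h))
    · apply hd
      refine h.trans (Nat.pow_sub_one_dvd_pow_sub_one p ?_)
      have : a - b = 1 ∨ b = 0 := by omega
      rcases this with h | h
      · simp [h]
      · simp [h]
  have hT : D = ⊤ := by
    apply Subgroup.eq_top_of_card_eq
    rw [hDb, hP, hab]
  have hle : P ≤ Subgroup.centralizer (Q : Set G) := Subgroup.subgroupOf_eq_top.1 hT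
  exact Subgroup.le_centralizer_iff.1 hle

theorem abNum_normalizer_le {G : Type} [Group G] [Finite G] {p a : ℕ} (hp : p.Prime)
    (P : Sylow p G) (hP : Nat.card P = p ^ a) (ha : a ≤ 2)
    (hd : ∀ q : ℕ, q.Prime → q ∣ Nat.card G → q ≠ p → ¬ q ∣ p ^ a - 1) :
    Subgroup.normalizer (P : Set G) ≤ Subgroup.centralizer (P : Set G) := by
  have := Fact.mk hp
  have hcomm : ∀ x y : P, x * y = y * x := by
    have : a = 0 ∨ a = 1 ∨ a = 2 := by omega
    rcases this with rfl | rfl | rfl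
    · rw [pow_zero] at hP
      have := (Nat.card_eq_one_iff_unique.1 hP).1
      exact fun x y => Subsingleton.elim _ _
    · rw [pow_one] at hP
      have := isCyclic_of_prime_card hP
      let := IsCyclic.commGroup (α := P)
      exact fun x y => mul_comm x y
    · exact (IsPGroup.isMulCommutative_of_card_eq_prime_sq hP).is_comm.comm
  have hPC : (P : Subgroup G) ≤ Subgroup.centralizer (P : Set G) := fun x hx y hy =>
    congrArg Subtype.val (hcomm ⟨y, hy⟩ ⟨x, hx⟩)
  set N := Subgroup.normalizer (P : Set G) with hNdef
  rw [← Subgroup.subgroupOf_eq_top, ← Subgroup.index_eq_one]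
  by_contra hne
  obtain ⟨q, hq, hqd⟩ := Nat.exists_prime_and_dvd hne
  have := Fact.mk hq
  let Q : Sylow q N := default
  have hQN : (Q : Subgroup N).map N.subtype ≤ N := Subgroup.map_subtype_le _
  have hQp : IsPGroup q ((Q : Subgroup N).map N.subtype) := Q.2.map _
  have hQC : (Q : Subgroup N).map N.subtype ≤ Subgroup.centralizer (P : Set G) := by
    by_cases hqp : q = p
    · subst hqp
      have := hQp.inf_normalizer_sylow P
      rw [inf_eq_left.2 hQN] at this
      exact (inf_eq_left.1 this.symm).trans hPC
    · refine abNum_le_centralizer hp hq hqp P _ hP ha hQp hQN (hd q hq ?_ hqp)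
      exact (hqd.trans (Subgroup.index_dvd_card _)).trans (Subgroup.card_subgroup_dvd_card N)
  have hQC' : (Q : Subgroup N) ≤ (Subgroup.centralizer (P : Set G)).subgroupOf N :=
    Subgroup.map_le_iff_le_comap.1 hQC
  exact Q.not_dvd_index (hqd.trans (Subgroup.index_dvd_of_le hQC'))

open scoped IsMulCommutative in
theorem abNum_not_dvd_commutator {G : Type} [Group G] [Finite G] {p : ℕ} (hp : p.Prime)
    (P : Sylow p G)
    (h : Subgroup.normalizer (P : Set G) ≤ Subgroup.centralizer (P : Set G)) :
    ¬ p ∣ Nat.card (commutator G) := by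
  have := Fact.mk hp
  have : IsMulCommutative P :=
    ⟨⟨fun a b => Subtype.ext (h (Subgroup.le_normalizer b.2) a a.2)⟩⟩
  intro hd
  exact MonoidHom.not_dvd_card_ker_transferSylow P h
    (hd.trans (Subgroup.card_dvd_of_le (Abelianization.commutator_subset_ker _)))

/-- A positive integer `n` is an abelian number (every group of order `n` is abelian)
iff in its prime factorization `n = p₁^a₁ ⋯ p_r^a_r` each exponent satisfies `aᵢ ≤ 2`
and `gcd(pᵢ, p_j^{a_j} - 1) = 1` whenever `i ≠ j`. -/
theorem abelian_number_iff (n : ℕ) (hn : 0 < n) :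
    (∀ (G : Type) [Group G] [Fintype G], Fintype.card G = n →
        ∀ x y : G, x * y = y * x) ↔
      ((∀ p ∈ n.primeFactors, n.factorization p ≤ 2) ∧
        ∀ p ∈ n.primeFactors, ∀ q ∈ n.primeFactors, p ≠ q →
          Nat.gcd p (q ^ n.factorization q - 1) = 1) := by
  constructor
  · intro H
    refine ⟨fun p hp => ?_, fun p hp q hq hpq => ?_⟩
    · have hpp := Nat.prime_of_mem_primeFactors hp
      by_contra hlt
      exact abNum_heis hn H hpp
        ((pow_dvd_pow p (by omega)).trans (Nat.ordProj_dvd n p))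
    · have hpp := Nat.prime_of_mem_primeFactors hp
      have hqp := Nat.prime_of_mem_primeFactors hq
      have ha : n.factorization q ≠ 0 :=
        (hqp.factorization_pos_of_dvd hn.ne' (Nat.dvd_of_mem_primeFactors hq)).ne'
      refine (Nat.Prime.coprime_iff_not_dvd hpp).2 (abNum_aff hn H hpp hqp ha ?_)
      refine Nat.Coprime.mul_dvd_of_dvd_of_dvd ?_ (Nat.ordProj_dvd n q)
        (Nat.dvd_of_mem_primeFactors hp)
      exact Nat.Coprime.pow_left _ ((Nat.coprime_primes hqp hpp).2 hpq.symm)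
  · rintro ⟨h1, h2⟩ G _ _ hG
    rw [Fintype.card_eq_nat_card] at hG
    have hc : Nat.card (commutator G) = 1 := by
      by_contra hne
      obtain ⟨p, hp, hpd⟩ := Nat.exists_prime_and_dvd hne
      have := Fact.mk hp
      have hpn : p ∈ n.primeFactors := Nat.mem_primeFactors.2
        ⟨hp, hG ▸ hpd.trans (Subgroup.card_subgroup_dvd_card _), hn.ne'⟩
      let P : Sylow p G := default
      have hP : Nat.card P = p ^ n.factorization p := by
        rw [← hG]; exact P.card_eq_multiplicity
      refine abNum_not_dvd_commutator hp P
        (abNum_normalizer_le hp P hP (h1 p hpn) fun q hq hqd hqp => ?_) hpd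
      exact (Nat.Prime.coprime_iff_not_dvd hq).1
        (h2 q (Nat.mem_primeFactors.2 ⟨hq, hG ▸ hqd, hn.ne'⟩) p hpn hqp)
    have hb : commutator G = ⊥ := Subgroup.card_eq_one.1 hc
    exact ((commutator_eq_bot_iff G).1 hb).is_comm.comm
end

section
/- A positive integer n is a nilpotent number (i.e., every group of order n is nilpotent) if and only if n has nilpotent factorization. -/
/-- A positive integer `n` with prime factorization `p₁^a₁ ⋯ p_r^a_r` has *nilpotent
factorization* if `pᵢ ∤ p_j^k - 1` for all `i ≠ j` and all `1 ≤ k ≤ a_j`. -/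
def HasNilpotentFactorization (n : ℕ) : Prop :=
  ∀ p ∈ n.primeFactors, ∀ q ∈ n.primeFactors, p ≠ q →
    ∀ k : ℕ, 1 ≤ k → k ≤ n.factorization q → ¬ (p ∣ q ^ k - 1)

open Subgroup in
/-- The semidirect product of the additive group of a field with a nontrivial cyclic group
of units has trivial center, hence is not nilpotent. -/
lemma exists_not_nilpotent (p q k : ℕ) (hp : p.Prime) (hq : q.Prime) (hk : 1 ≤ k)
    (h : p ∣ q ^ k - 1) :
    ∃ (G : Type) (_ : Group G), Nat.card G = q ^ k * p ∧ ¬ Group.IsNilpotent G := by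
  classical
  have := Fact.mk hp
  have := Fact.mk hq
  let F := GaloisField q k
  have hF : Nat.card F = q ^ k := GaloisField.card q k (by omega)
  have : Finite F := Nat.finite_of_card_ne_zero (by rw [hF]; exact pow_ne_zero _ hq.ne_zero)
  have := Fintype.ofFinite F
  obtain ⟨u, hu⟩ := exists_prime_orderOf_dvd_card (G := Fˣ) p (by
    rw [Fintype.card_units, ← Nat.card_eq_fintype_card, hF]; exact h)
  let φ : zpowers u →* MulAut (Multiplicative F) :=
    (MulAutMultiplicative F).symm.toMonoidHom.comp
      ((DistribMulAction.toAddAut Fˣ F).comp (zpowers u).subtype)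
  have hφ : ∀ (b : zpowers u) (x : Multiplicative F),
    φ b x = Multiplicative.ofAdd (((b : Fˣ) : F) * x.toAdd) := fun b x => rfl
  refine ⟨Multiplicative F ⋊[φ] zpowers u, inferInstance, ?_, ?_⟩
  · rw [SemidirectProduct.card, Nat.card_zpowers, hu]
    congr 1
  · intro hnil
    have : Nontrivial (Multiplicative F ⋊[φ] zpowers u) :=
      (SemidirectProduct.inl_injective (φ := φ)).nontrivial
    apply Group.IsNilpotent.center_ne_bot (Multiplicative F ⋊[φ] zpowers u)
    rw [eq_bot_iff]
    intro z hz
    rw [mem_center_iff] at hz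
    have h1 := congrArg SemidirectProduct.left (hz (SemidirectProduct.inl (Multiplicative.ofAdd 1)))
    have h2 := congrArg SemidirectProduct.left (hz (SemidirectProduct.inr ⟨u, mem_zpowers u⟩))
    simp only [SemidirectProduct.mul_left, SemidirectProduct.left_inl, SemidirectProduct.right_inl,
      SemidirectProduct.left_inr, SemidirectProduct.right_inr, map_one, hφ,
      MulAut.one_apply, one_mul, mul_one] at h1 h2
    rw [mul_comm] at h1
    have h1' := congrArg Multiplicative.toAdd (mul_left_cancel h1)
    have h2' := congrArg Multiplicative.toAdd h2
    simp only [toAdd_ofAdd, mul_one] at h1' h2'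
    have hu1 : (u : F) ≠ 1 := by
      intro e
      have : u = 1 := Units.ext e
      rw [this, orderOf_one] at hu
      exact hp.one_lt.ne hu
    rw [mem_bot]
    apply SemidirectProduct.ext
    · have : Multiplicative.toAdd z.left = 0 := by
        by_contra hne
        exact hu1 (mul_right_cancel₀ hne (by
          rw [h2', one_mul, toAdd_mul, toAdd_ofAdd, toAdd_one, mul_zero, add_zero]))
      exact this
    · exact Subtype.ext (Units.ext h1'.symm)

lemma fwd (n : ℕ) (hn : 0 < n)
    (H : ∀ (G : Type) [Group G] [Fintype G], Fintype.card G = n → Group.IsNilpotent G) :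
    HasNilpotentFactorization n := by
  intro p hp q hq hpq k hk hkn hdvd
  have hp' := Nat.prime_of_mem_primeFactors hp
  have hq' := Nat.prime_of_mem_primeFactors hq
  obtain ⟨G, _, hG, hnil⟩ := exists_not_nilpotent p q k hp' hq' hk hdvd
  have hd : q ^ k * p ∣ n := by
    apply Nat.Coprime.mul_dvd_of_dvd_of_dvd
    · exact Nat.Coprime.pow_left _ ((Nat.coprime_primes hq' hp').2 hpq.symm)
    · exact (pow_dvd_pow q hkn).trans (Nat.ordProj_dvd n q)
    · exact Nat.dvd_of_mem_primeFactors hp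
  obtain ⟨m, rfl⟩ := hd
  have hm : m ≠ 0 := by rintro rfl; simp at hn
  have := NeZero.mk hm
  have : Finite G := Nat.finite_of_card_ne_zero (by
    rw [hG]; exact mul_ne_zero (pow_ne_zero _ hq'.ne_zero) hp'.ne_zero)
  have := Fintype.ofFinite G
  have := H (G × Multiplicative (ZMod m)) (by
    rw [Fintype.card_prod, Fintype.card_multiplicative, ZMod.card, ← hG, Nat.card_eq_fintype_card])
  exact hnil (Group.nilpotent_of_surjective (MonoidHom.fst G (Multiplicative (ZMod m)))
    Prod.fst_surjective)

lemma HasNilpotentFactorization.dvd {m n : ℕ} (hn : n ≠ 0) (hmn : m ∣ n)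
    (h : HasNilpotentFactorization n) : HasNilpotentFactorization m := by
  intro p hp q hq hpq k hk hkn
  have hs := Nat.primeFactors_mono hmn hn
  refine h p (hs hp) q (hs hq) hpq k hk (hkn.trans ?_)
  exact (Nat.factorization_le_iff_dvd (ne_zero_of_dvd_ne_zero hn hmn) hn).2 hmn q

/-- A `p`-group acting on a `q`-group of order `q ^ b` acts trivially if
`p` divides no `q ^ k - 1` for `1 ≤ k ≤ b`. -/
lemma fixed_of_coprime {p q b : ℕ} [Fact p.Prime] [Fact q.Prime] (hpq : p ≠ q)
    {P Q : Type*} [Group P] [Group Q] [Finite Q] [MulDistribMulAction P Q]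
    (hP : IsPGroup p P) (hQ : Nat.card Q = q ^ b)
    (h : ∀ k, 1 ≤ k → k ≤ b → ¬ p ∣ q ^ k - 1) (g : P) (x : Q) : g • x = x := by
  have hmod := hP.card_modEq_card_fixedPoints Q
  have hdvd : Nat.card (FixedPoints.subgroup P Q) ∣ q ^ b :=
    hQ ▸ Subgroup.card_subgroup_dvd_card _
  obtain ⟨c, hc, hcard⟩ := (Nat.dvd_prime_pow Fact.out).1 hdvd
  have hfix : Nat.card (MulAction.fixedPoints P Q) = q ^ c := hcard
  have hqp : q.Prime := Fact.out
  have hbc : c = b := by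
    by_contra hne
    rw [hQ, hfix] at hmod
    have h1 := (Nat.modEq_iff_dvd' (pow_le_pow_right₀ hqp.one_lt.le hc)).1 hmod.symm
    have h2 : q ^ b - q ^ c = q ^ c * (q ^ (b - c) - 1) := by
      rw [Nat.mul_sub, ← pow_add, mul_one, Nat.add_sub_cancel' hc]
    rw [h2] at h1
    refine h (b - c) (by omega) (by omega) (Nat.Coprime.dvd_of_dvd_mul_left ?_ h1)
    exact Nat.Coprime.pow_right _ ((Nat.coprime_primes Fact.out hqp).2 hpq)
  have htop : FixedPoints.subgroup P Q = ⊤ := by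
    apply Subgroup.eq_top_of_card_eq
    rw [hcard, hQ, hbc]
  have hx : x ∈ FixedPoints.subgroup P Q := htop ▸ Subgroup.mem_top x
  exact hx g

/-- A nontrivial normal `q`-subgroup forces a nontrivial center. -/
lemma center_ne_bot_of_normal {G : Type*} [Group G] [Finite G]
    (h : HasNilpotentFactorization (Nat.card G)) {q : ℕ} [hq : Fact q.Prime]
    (Q : Subgroup G) [Q.Normal] (hQ : IsPGroup q Q) (hne : Q ≠ ⊥) :
    Subgroup.center G ≠ ⊥ := by
  obtain ⟨b, hb⟩ := hQ.exists_card_eq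
  have hb0 : b ≠ 0 := by
    rintro rfl
    exact hne (Subgroup.card_eq_one.1 (by simpa using hb))
  have hqb : q ^ b ∣ Nat.card G := hb ▸ Subgroup.card_subgroup_dvd_card Q
  have hG0 : Nat.card G ≠ 0 := Nat.card_pos.ne'
  have hqG : q ∈ (Nat.card G).primeFactors :=
    Nat.mem_primeFactors.2 ⟨hq.out, (dvd_pow_self q hb0).trans hqb, hG0⟩
  have hbq : b ≤ (Nat.card G).factorization q :=
    (hq.out.pow_dvd_iff_le_factorization hG0).1 hqb
  letI act (P : Subgroup G) : MulDistribMulAction P Q :=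
    MulDistribMulAction.compHom Q ((MulAut.conjNormal (H := Q)).comp P.subtype)
  have hact : ∀ (P : Subgroup G) (g : P) (x : Q),
    (((act P).toMulAction.toSMul.smul g x : Q) : G) = g * x * (g : G)⁻¹ := fun P g x => rfl
  obtain ⟨S⟩ : Nonempty (Sylow q G) := inferInstance
  obtain ⟨z, hz, hz1⟩ :=
    letI := act S
    S.isPGroup'.exists_fixed_point_of_prime_dvd_card_of_fixed_point Q
      (hb ▸ dvd_pow_self q hb0) (a := 1) (fun g => smul_one g)
  have hSz : ∀ g ∈ (S : Subgroup G), g * z * g⁻¹ = z := by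
    intro g hg
    have := congrArg Subtype.val (hz ⟨g, hg⟩)
    exact this
  have hcent : ∀ (p : ℕ) (_ : Fact p.Prime), ∃ P : Sylow p G,
      ∀ g ∈ (P : Subgroup G), g * z * g⁻¹ = z := by
    intro p hp
    by_cases hpq : p = q
    · subst hpq
      exact ⟨S, hSz⟩
    obtain ⟨P⟩ : Nonempty (Sylow p G) := inferInstance
    refine ⟨P, fun g hg => ?_⟩
    by_cases hpG : p ∈ (Nat.card G).primeFactors
    · letI := act P
      have := fixed_of_coprime hpq P.isPGroup' hb
        (fun k hk hkb => h p hpG q hqG hpq k hk (hkb.trans hbq)) ⟨g, hg⟩ z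
      exact congrArg Subtype.val this
    · have hc := P.card_eq_multiplicity
      rw [← Nat.support_factorization, Finsupp.notMem_support_iff] at hpG
      rw [hpG, pow_zero, Subgroup.card_eq_one] at hc
      rw [hc, Subgroup.mem_bot] at hg
      simp [hg]
  have htop : Subgroup.centralizer {(z : G)} = ⊤ := by
    apply Subgroup.eq_top_of_card_eq
    apply Nat.dvd_antisymm (Subgroup.card_subgroup_dvd_card _)
    rw [Nat.dvd_iff_prime_pow_dvd_dvd]
    intro p k hp hk
    have := Fact.mk hp
    obtain ⟨P, hP⟩ := hcent p inferInstance
    have h1 : (P : Subgroup G) ≤ Subgroup.centralizer {(z : G)} := by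
      intro g hg
      rw [Subgroup.mem_centralizer_singleton_iff]
      exact (mul_inv_eq_iff_eq_mul.1 (hP g hg))
    refine dvd_trans ?_ (Subgroup.card_dvd_of_le h1)
    rw [P.card_eq_multiplicity]
    exact pow_dvd_pow p ((hp.pow_dvd_iff_le_factorization hG0).1 hk)
  intro hbot
  have hzc : (z : G) ∈ Subgroup.center G := by
    rw [Subgroup.mem_center_iff]
    intro g
    have : g ∈ Subgroup.centralizer {(z : G)} := htop ▸ Subgroup.mem_top g
    exact Subgroup.mem_centralizer_singleton_iff.1 this
  rw [hbot, Subgroup.mem_bot] at hzc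
  exact hz1 (Subtype.ext hzc.symm)

/-- In a nilpotent subgroup, normalizers grow. -/
lemma exists_normalizer {G : Type*} [Group G] {M I : Subgroup G} (hM : Group.IsNilpotent M)
    (hI : I < M) : ∃ x ∈ M, x ∉ I ∧ x ∈ Subgroup.normalizer (I : Set G) := by
  have hlt : I.subgroupOf M < ⊤ := by
    rw [lt_top_iff_ne_top, Ne, Subgroup.subgroupOf_eq_top]
    exact not_le_of_gt hI
  have := Group.normalizerCondition_of_isNilpotent (G := M) _ hlt
  obtain ⟨x, hx, hxI⟩ := SetLike.exists_of_lt this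
  refine ⟨x, x.2, fun hh => hxI (Subgroup.mem_subgroupOf.2 hh), ?_⟩
  rw [Subgroup.mem_normalizer_iff] at hx ⊢
  intro g
  by_cases hg : g ∈ M
  · exact hx ⟨g, hg⟩
  · constructor
    · intro h; exact absurd (hI.le h) hg
    · intro h
      exfalso
      apply hg
      have h1 := M.mul_mem (M.mul_mem (M.inv_mem x.2) (hI.le h)) x.2
      simpa [mul_assoc] using h1

/-- In a simple group all of whose proper subgroups are nilpotent, maximal subgroups
intersect trivially. -/
lemma coatom_inf {G : Type*} [Group G] [Finite G]
    (hs : ∀ N : Subgroup G, N.Normal → N = ⊥ ∨ N = ⊤)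
    (hnil : ∀ M : Subgroup G, M ≠ ⊤ → Group.IsNilpotent M)
    (M L : Subgroup G) (hM : IsCoatom M) (hL : IsCoatom L) (hne : M ≠ L) : M ⊓ L = ⊥ := by
  induction hd : Nat.card G - Nat.card (M ⊓ L : Subgroup G) using Nat.strong_induction_on
    generalizing M L with
  | _ d ih =>
  by_contra hI
  have hMlt : M ⊓ L < M := by
    refine lt_of_le_of_ne inf_le_left fun h => ?_
    have h1 : M ≤ L := inf_eq_left.1 h
    exact hne (hM.le_iff.1 h1 |>.resolve_left hL.1 |>.symm)
  have hLlt : M ⊓ L < L := by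
    refine lt_of_le_of_ne inf_le_right fun h => ?_
    have h1 : L ≤ M := inf_eq_right.1 h
    exact hne (hL.le_iff.1 h1 |>.resolve_left hM.1)
  have hN : Subgroup.normalizer ((M ⊓ L : Subgroup G) : Set G) ≠ ⊤ := by
    intro h
    rcases hs _ (Subgroup.normalizer_eq_top_iff.1 h) with h | h
    · exact hI h
    · exact hM.1 (top_le_iff.1 (h ▸ inf_le_left))
  obtain ⟨K, hK, hNK⟩ := (eq_top_or_exists_le_coatom _).resolve_left hN
  have key : ∀ A : Subgroup G, IsCoatom A → M ⊓ L < A → A = K := by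
    intro A hA hlt
    by_contra hAK
    obtain ⟨x, hxA, hxI, hxN⟩ := exists_normalizer (hnil A hA.1) hlt
    have hlt2 : M ⊓ L < A ⊓ K := by
      refine lt_of_le_of_ne (le_inf hlt.le (Subgroup.le_normalizer.trans hNK)) fun h => ?_
      exact hxI (h ▸ ⟨hxA, hNK hxN⟩)
    have hc : Nat.card (M ⊓ L : Subgroup G) < Nat.card (A ⊓ K : Subgroup G) :=
      Set.ncard_lt_ncard hlt2 (Set.toFinite _)
    have hc2 : Nat.card (A ⊓ K : Subgroup G) ≤ Nat.card G := Subgroup.card_le_card_group _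
    have := ih _ (by omega) A K hA hK hAK rfl
    rw [this] at hlt2
    exact not_lt_bot hlt2
  exact hne ((key M hM hMlt).trans (key L hL hLlt).symm)

/-- The conjugation map covering the conjugates of `M`. -/
noncomputable def conjMap {G : Type*} [Group G] (M : Subgroup G) :
    (G ⧸ M) × {m : M // m ≠ 1} → G := fun x => x.1.out * x.2.1 * (x.1.out)⁻¹

lemma conjMap_ne_one {G : Type*} [Group G] (M : Subgroup G) (x) : conjMap M x ≠ 1 := by
  intro h
  apply x.2.2
  simpa [conjMap] using h

lemma mem_range_conjMap {G : Type*} [Group G] (M : Subgroup G) (x g : G) (hx : x ≠ 1)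
    (h : g⁻¹ * x * g ∈ M) : x ∈ Set.range (conjMap M) := by
  obtain ⟨m, hm⟩ := QuotientGroup.mk_out_eq_mul M g
  have hmem : (g * m)⁻¹ * x * (g * m) ∈ M := by
    have := M.mul_mem (M.mul_mem (M.inv_mem m.2) h) m.2
    simpa [mul_assoc] using this
  refine ⟨⟨(g : G ⧸ M), ⟨⟨_, hmem⟩, ?_⟩⟩, ?_⟩
  · intro h1
    apply hx
    have := congrArg Subtype.val h1
    simp only [Subgroup.coe_one] at this
    have h2 : x = (g * m) * ((g * m)⁻¹ * x * (g * m)) * (g * m)⁻¹ := by group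
    rw [h2, this]; group
  · simp only [conjMap, hm]; group

lemma card_conjMap {G : Type*} [Group G] [Finite G] (M : Subgroup G) :
    Nat.card ((G ⧸ M) × {m : M // m ≠ 1}) = Nat.card G - M.index := by
  classical
  have := Fintype.ofFinite M
  have h1 : Nat.card {m : M // m ≠ 1} = Nat.card M - 1 := by
    rw [Nat.card_eq_fintype_card, Nat.card_eq_fintype_card]
    simp
  rw [Nat.card_prod, h1, ← M.index_mul_card, Nat.mul_sub, mul_one]
  rfl

/-- A finite group without proper nontrivial normal subgroups, all of whose proper subgroups
are nilpotent, is nilpotent. -/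
lemma nilpotent_of_simple {G : Type*} [Group G] [Finite G] [Nontrivial G]
    (hs : ∀ N : Subgroup G, N.Normal → N = ⊥ ∨ N = ⊤)
    (hnil : ∀ M : Subgroup G, M ≠ ⊤ → Group.IsNilpotent M) : Group.IsNilpotent G := by
  classical
  by_cases hcyc : ∃ x : G, Subgroup.zpowers x = ⊤
  · obtain ⟨x, hx⟩ := hcyc
    have hcen : Subgroup.center G = ⊤ := by
      rw [eq_top_iff]
      intro g _
      rw [Subgroup.mem_center_iff]
      intro y
      obtain ⟨a, rfl⟩ := Subgroup.mem_zpowers_iff.1 (hx ▸ Subgroup.mem_top g)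
      obtain ⟨b, rfl⟩ := Subgroup.mem_zpowers_iff.1 (hx ▸ Subgroup.mem_top y)
      exact zpow_mul_comm x b a
    letI : CommGroup G := { ‹Group G› with
      mul_comm := fun a b =>
        (Subgroup.mem_center_iff.1 (hcen ▸ Subgroup.mem_top b : b ∈ Subgroup.center G) a) }
    exact CommGroup.isNilpotent
  exfalso
  push Not at hcyc
  have hcov : ∀ x : G, ∃ M : Subgroup G, IsCoatom M ∧ x ∈ M := by
    intro x
    obtain ⟨M, hM, hle⟩ := (eq_top_or_exists_le_coatom _).resolve_left (hcyc x)
    exact ⟨M, hM, hle (Subgroup.mem_zpowers x)⟩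
  have hnb : ∀ M : Subgroup G, IsCoatom M → M ≠ ⊥ := by
    rintro M hM rfl
    obtain ⟨x, hx⟩ := exists_ne (1 : G)
    obtain ⟨L, hL, hxL⟩ := hcov x
    rcases hM.le_iff.1 (bot_le : ⊥ ≤ L) with h | h
    · exact hL.1 h
    · rw [h] at hxL; exact hx hxL
  have hself : ∀ M : Subgroup G, IsCoatom M → Subgroup.normalizer (M : Set G) = M := by
    intro M hM
    rcases hM.le_iff.1 (Subgroup.le_normalizer (H := M)) with h | h
    · rcases hs _ (Subgroup.normalizer_eq_top_iff.1 h) with h | h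
      · exact absurd h (hnb M hM)
      · exact absurd h hM.1
    · exact h
  have hconj : ∀ (M : Subgroup G) (g : G), IsCoatom M →
      IsCoatom (M.map (MulAut.conj g).toMonoidHom) := by
    intro M g hM
    exact ((MulAut.conj g).mapSubgroup.isCoatom_iff M).2 hM
  have hmemc : ∀ (M : Subgroup G) (g x : G),
      x ∈ M.map (MulAut.conj g).toMonoidHom ↔ g⁻¹ * x * g ∈ M := by
    intro M g x
    constructor
    · rintro ⟨y, hy, rfl⟩
      simpa [mul_assoc] using hy
    · intro h
      exact ⟨_, h, by simp [mul_assoc]⟩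
  -- two maximal conjugates sharing a nontrivial element coincide
  have hshare : ∀ (M L : Subgroup G) (g k x : G), IsCoatom M → IsCoatom L → x ≠ 1 →
      g⁻¹ * x * g ∈ M → k⁻¹ * x * k ∈ L →
      M.map (MulAut.conj g).toMonoidHom = L.map (MulAut.conj k).toMonoidHom := by
    intro M L g k x hM hL hx h1 h2
    by_contra hne
    have := coatom_inf hs hnil _ _ (hconj M g hM) (hconj L k hL) hne
    apply hx
    rw [← Subgroup.mem_bot, ← this]
    exact ⟨(hmemc _ _ _).2 h1, (hmemc _ _ _).2 h2⟩
  have hself' : ∀ (M : Subgroup G) (x), (conjMap M x) = conjMap M x →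
      (x.1.out)⁻¹ * conjMap M x * x.1.out ∈ M := by
    intro M x _
    have : (x.1.out)⁻¹ * conjMap M x * x.1.out = x.2.1 := by
      simp only [conjMap]; group
    rw [this]; exact x.2.1.2
  have hinj : ∀ M : Subgroup G, IsCoatom M → Function.Injective (conjMap M) := by
    intro M hM x y hxy
    have e := hshare M M x.1.out y.1.out (conjMap M x) hM hM (conjMap_ne_one M x)
      (hself' M x rfl) (by rw [hxy]; exact hself' M y rfl)
    have hq : x.1 = y.1 := by
      rw [← QuotientGroup.out_eq' x.1, ← QuotientGroup.out_eq' y.1, QuotientGroup.eq]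
      suffices hh : x.1.out⁻¹ * y.1.out ∈ Subgroup.normalizer (M : Set G) from (hself M hM).le hh
      rw [Subgroup.mem_normalizer_iff]
      intro h
      have e1 := (hmemc M x.1.out (y.1.out * h * y.1.out⁻¹))
      have e2 := (hmemc M y.1.out (y.1.out * h * y.1.out⁻¹))
      rw [e] at e1
      have e3 := e2.symm.trans e1
      simpa [mul_assoc] using e3
    obtain ⟨x1, x2⟩ := x
    obtain ⟨y1, y2⟩ := y
    simp only at hq
    subst hq
    simp only [conjMap, mul_left_inj, mul_right_inj] at hxy
    rw [Prod.mk.injEq]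
    exact ⟨rfl, Subtype.ext (Subtype.ext hxy)⟩
  have hcard : ∀ M : Subgroup G, IsCoatom M →
      (Set.range (conjMap M)).ncard = Nat.card G - M.index := by
    intro M hM
    rw [← card_conjMap, ← Nat.card_coe_set_eq, Nat.card_range_of_injective (hinj M hM)]
  have hidx : ∀ M : Subgroup G, IsCoatom M → 2 * M.index ≤ Nat.card G := by
    intro M hM
    rw [← M.card_mul_index]
    exact Nat.mul_le_mul_right _ ((Subgroup.one_lt_card_iff_ne_bot M).2 (hnb M hM))
  obtain ⟨M, hM, -⟩ := hcov 1
  have hM1 : 2 ≤ M.index := by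
    have h1 : M.index ≠ 1 := fun h => hM.1 (Subgroup.index_eq_one.1 h)
    have h2 : M.index ≠ 0 := Subgroup.index_ne_zero_of_finite
    omega
  obtain ⟨x, hx⟩ : ∃ x, x ∉ insert 1 (Set.range (conjMap M)) := by
    by_contra hall
    push Not at hall
    have h1 := Set.ncard_insert_le 1 (Set.range (conjMap M))
    rw [Set.eq_univ_of_forall hall, Set.ncard_univ, hcard M hM] at h1
    have := hidx M hM
    omega
  rw [Set.mem_insert_iff, not_or] at hx
  obtain ⟨L, hL, hxL⟩ := hcov x
  have hdisj : Disjoint (Set.range (conjMap M)) (Set.range (conjMap L)) := by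
    rw [Set.disjoint_left]
    rintro _ ⟨a, rfl⟩ ⟨b, hb⟩
    have e := hshare M L a.1.out b.1.out (conjMap M a) hM hL (conjMap_ne_one M a)
      (hself' M a rfl) (by rw [← hb]; exact hself' L b rfl)
    apply hx.2
    have h1 := (hmemc L b.1.out (b.1.out * x * b.1.out⁻¹)).2 (by simpa [mul_assoc] using hxL)
    rw [← e, hmemc] at h1
    exact mem_range_conjMap M x (b.1.out⁻¹ * a.1.out) hx.1 (by simpa [mul_assoc] using h1)
  have h1 : (1 : G) ∉ Set.range (conjMap M) ∪ Set.range (conjMap L) := by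
    rintro (⟨a, ha⟩ | ⟨a, ha⟩)
    · exact conjMap_ne_one _ _ ha
    · exact conjMap_ne_one _ _ ha
  have h2 := Set.ncard_insert_of_notMem h1
  rw [Set.ncard_union_eq hdisj, hcard M hM, hcard L hL] at h2
  have h3 := Set.ncard_le_card (insert 1 (Set.range (conjMap M) ∪ Set.range (conjMap L)))
  have := hidx M hM
  have := hidx L hL
  omega

lemma bwd (n : ℕ) : ∀ (G : Type) [Group G] [Finite G], Nat.card G = n →
    HasNilpotentFactorization n → Group.IsNilpotent G := by
  induction n using Nat.strong_induction_on with
  | _ n ih =>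
  intro G _ _ hG hn
  subst hG
  have hG0 : Nat.card G ≠ 0 := Nat.card_pos.ne'
  have hsub : ∀ M : Subgroup G, M ≠ ⊤ → Group.IsNilpotent M := by
    intro M hM
    refine ih _ ?_ M rfl (hn.dvd hG0 (Subgroup.card_subgroup_dvd_card M))
    exact lt_of_le_of_ne (Subgroup.card_le_card_group M)
      fun h => hM (Subgroup.eq_top_of_card_eq M h)
  rcases subsingleton_or_nontrivial G with hsg | hnt
  · infer_instance
  by_cases hs : ∀ N : Subgroup G, N.Normal → N = ⊥ ∨ N = ⊤
  · exact nilpotent_of_simple hs hsub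
  push Not at hs
  obtain ⟨N, hN, hNb, hNt⟩ := hs
  have := hsub N hNt
  have hc1 : Nat.card N ≠ 1 := fun h => hNb (Subgroup.card_eq_one.1 h)
  obtain ⟨q, hq, hqN⟩ := Nat.exists_prime_and_dvd hc1
  have := Fact.mk hq
  obtain ⟨S⟩ : Nonempty (Sylow q N) := inferInstance
  have : (S : Subgroup N).Characteristic := S.characteristic_of_normal inferInstance
  have : ((S : Subgroup N).map N.subtype).Normal := ConjAct.normal_of_characteristic_of_normal
  have hSne : (S : Subgroup N).map N.subtype ≠ ⊥ := by
    rw [Ne, Subgroup.map_eq_bot_iff_of_injective _ N.subtype_injective]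
    exact S.ne_bot_of_dvd_card hqN
  have hZ := center_ne_bot_of_normal hn _ (S.isPGroup'.map N.subtype) hSne
  apply Group.of_quotient_center_nilpotent
  have hcard := (Subgroup.center G).card_eq_card_quotient_mul_card_subgroup
  refine ih _ ?_ (G ⧸ Subgroup.center G) rfl (hn.dvd hG0 (Dvd.intro _ hcard.symm))
  have h1 := (Subgroup.one_lt_card_iff_ne_bot _).2 hZ
  have h2 : 0 < Nat.card (G ⧸ Subgroup.center G) := Nat.card_pos
  rw [hcard]
  exact lt_mul_of_one_lt_right h2 h1

/-- A positive integer `n` is a nilpotent number (every group of order `n` is nilpotent)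
iff `n` has nilpotent factorization. -/
theorem nilpotent_number_iff (n : ℕ) (hn : 0 < n) :
    (∀ (G : Type) [Group G] [Fintype G], Fintype.card G = n → Group.IsNilpotent G) ↔
      HasNilpotentFactorization n := by
  constructor
  · exact fwd n hn
  · intro h G _ _ hG
    exact bwd n G (by rw [Nat.card_eq_fintype_card, hG]) h
end
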